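/- For any bijection f : {0,1}^n → {1,...,2^{n₁}} × {1,...,2^{n₂}} with n = n₁ + n₂, n₁, n₂ ≥ 2, the inequality Σ_{i=1}^{2^{n₁−1}} θ(n, f^{-1}(F_i^{n₁} × N_{2^{n₂}})) ≥ Σ_{i=1}^{2^{n₁−1}} θ(n, ξ_{n₁n₂}^{-1}(F_i^{n₁} × N_{2^{n₂}})) holds, where F_i^{n₁} = {i,...,i+2^{n₁−1}−1} and N_{2^{n₂}} = {1,...,2^{n₂}}. -/

import Mathlib

open Finset

/-- Number of coordinates in which two 0-1 vectors differ. -/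
def diffCount {n : ℕ} (u v : Fin n → Bool) : ℕ :=
  (Finset.univ.filter fun i => u i ≠ v i).card

/-- Adjacency in the hypercube `Q_n`: differ in exactly one coordinate. -/
def cubeAdj {n : ℕ} (u v : Fin n → Bool) : Prop := diffCount u v = 1

instance {n : ℕ} (u v : Fin n → Bool) : Decidable (cubeAdj u v) :=
  inferInstanceAs (Decidable (diffCount u v = 1))

/-- `theta n S`: number of edges of `Q_n` with exactly one endpoint in `S`. -/
def theta (n : ℕ) (S : Finset (Fin n → Bool)) : ℕ :=
  ((Finset.univ ×ˢ Finset.univ).filter fun p : (Fin n → Bool) × (Fin n → Bool) =>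
    p.1 ∈ S ∧ p.2 ∉ S ∧ cubeAdj p.1 p.2).card

/-- The reflected Gray code map `ξ_n : {0,1}^n → {1,...,2^n}`. -/
def gray : (n : ℕ) → (Fin n → Bool) → ℕ
  | 0, _ => 1
  | n + 1, v =>
    if v 0 = false then gray n (fun i => v i.succ)
    else 2 ^ (n + 1) + 1 - gray n (fun i => v i.succ)

/-- Wirelength of an embedding `f` of `Q_n` into a host with distance `d`. -/
def wirelength {n : ℕ} {α : Type*} (d : α → α → ℕ) (f : (Fin n → Bool) → α) : ℕ :=
  (∑ u : Fin n → Bool, ∑ v : Fin n → Bool, if cubeAdj u v then d (f u) (f v) else 0) / 2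

/-- Cyclic distance on the cycle with `m` vertices labeled `1,...,m`. -/
def cycDist (m a b : ℕ) : ℕ := min (Nat.dist a b) (m - Nat.dist a b)

/-- The 2-order Gray code map. -/
def gray2 (n₁ n₂ : ℕ) (v : Fin (n₁ + n₂) → Bool) : ℕ × ℕ :=
  (gray n₁ fun i => v (Fin.castAdd n₂ i), gray n₂ fun i => v (Fin.natAdd n₁ i))

/-- The size of the edge boundary of an initial segment of length `a` of `{0,1}^m` in the
lexicographic order, which is the least edge boundary of a set of `a` vertices. -/
def lexBoundary : ℕ → ℤ → ℤ
  | 0, _ => 0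
  | m + 1, a =>
    if a ≤ 2 ^ m then a + lexBoundary m a else 2 ^ (m + 1) - a + lexBoundary m (a - 2 ^ m)

lemma lexBoundary_zero_right (m : ℕ) : lexBoundary m 0 = 0 := by
  induction m with
  | zero => rfl
  | succ m ih => simp [lexBoundary, ih]

lemma lexBoundary_succ_of_le {m : ℕ} {a : ℤ} (h : a ≤ 2 ^ m) :
    lexBoundary (m + 1) a = a + lexBoundary m a := by
  simp [lexBoundary, h]

lemma lexBoundary_two_pow (m : ℕ) : lexBoundary m (2 ^ m) = 0 := by
  induction m with
  | zero => rfl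
  | succ m ih =>
    have : (0 : ℤ) < 2 ^ m := by positivity
    have e : (2 : ℤ) ^ (m + 1) - 2 ^ m = 2 ^ m := by ring
    have h : ¬ (2 : ℤ) ^ (m + 1) ≤ 2 ^ m := by rw [pow_succ]; linarith
    simp [lexBoundary, h, e, ih]

lemma lexBoundary_succ_of_ge {m : ℕ} {a : ℤ} (h : 2 ^ m ≤ a) :
    lexBoundary (m + 1) a = 2 ^ (m + 1) - a + lexBoundary m (a - 2 ^ m) := by
  rcases h.eq_or_lt with rfl | h
  · rw [lexBoundary_succ_of_le le_rfl, sub_self, lexBoundary_two_pow, lexBoundary_zero_right]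
    ring
  · simp [lexBoundary, not_le.2 h]

lemma lexBoundary_two_pow_sub (m : ℕ) (a : ℤ) : lexBoundary m (2 ^ m - a) = lexBoundary m a := by
  induction m generalizing a with
  | zero => rfl
  | succ m ih =>
    have e : (2 : ℤ) ^ (m + 1) = 2 * 2 ^ m := by ring
    rcases le_total a (2 ^ m) with h | h
    · rw [lexBoundary_succ_of_le h, lexBoundary_succ_of_ge (by linarith), ← ih a,
        show (2 : ℤ) ^ (m + 1) - a - 2 ^ m = 2 ^ m - a by rw [e]; ring]
      ring
    · rw [lexBoundary_succ_of_ge h, lexBoundary_succ_of_le (by linarith), ← ih (a - 2 ^ m),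
        show (2 : ℤ) ^ m - (a - 2 ^ m) = 2 ^ (m + 1) - a by rw [e]; ring]

lemma lexBoundary_nonneg (m : ℕ) {a : ℤ} (h₀ : 0 ≤ a) (h₁ : a ≤ 2 ^ m) :
    0 ≤ lexBoundary m a := by
  induction m generalizing a with
  | zero => exact le_rfl
  | succ m ih =>
    have e : (2 : ℤ) ^ (m + 1) = 2 * 2 ^ m := by ring
    rcases le_total a (2 ^ m) with h | h
    · rw [lexBoundary_succ_of_le h]
      linarith [ih h₀ h]
    · rw [lexBoundary_succ_of_ge h]
      linarith [ih (sub_nonneg.2 h) (by linarith)]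

/-- If the profile in dimension `m` satisfies the merging inequality, it is subadditive in
dimension `m + 1`; both statements are proved together. -/
lemma lexBoundary_merge_and_subadditive (m : ℕ) :
    (∀ x y : ℤ, 0 ≤ x → x ≤ 2 ^ m → 0 ≤ y → y ≤ 2 ^ m →
      lexBoundary (m + 1) (x + y) ≤ lexBoundary m x + lexBoundary m y + |x - y|) ∧
    (∀ x y : ℤ, 0 ≤ x → 0 ≤ y → x + y ≤ 2 ^ m →
      lexBoundary m (x + y) ≤ lexBoundary m x + lexBoundary m y) := by
  induction m with
  | zero =>
    refine ⟨fun x y hx hx' hy hy' => ?_, fun x y _ _ _ => by simp [lexBoundary]⟩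
    norm_num at hx' hy'
    have h1 : x = 0 ∨ x = 1 := by omega
    have h2 : y = 0 ∨ y = 1 := by omega
    rcases h1 with rfl | rfl <;> rcases h2 with rfl | rfl <;> norm_num [lexBoundary]
  | succ m ih =>
    obtain ⟨merge, subadd⟩ := ih
    have e : (2 : ℤ) ^ (m + 1) = 2 * 2 ^ m := by ring
    have e' : (2 : ℤ) ^ (m + 1 + 1) = 4 * 2 ^ m := by ring
    have mixed : ∀ x y : ℤ, 2 ^ m ≤ x → x ≤ 2 ^ (m + 1) → 0 ≤ y → y ≤ 2 ^ m →
        lexBoundary (m + 1 + 1) (x + y) ≤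
          lexBoundary (m + 1) x + lexBoundary (m + 1) y + |x - y| := by
      intro x y hx hx' hy hy'
      rw [lexBoundary_succ_of_ge hx, lexBoundary_succ_of_le hy', abs_of_nonneg (by linarith)]
      rcases le_total (x + y) (2 ^ (m + 1)) with h | h
      · rw [lexBoundary_succ_of_le h, lexBoundary_succ_of_ge (by linarith),
          show x + y - 2 ^ m = (x - 2 ^ m) + y by ring]
        linarith [subadd (x - 2 ^ m) y (by linarith) hy (by linarith)]
      · have := subadd (2 ^ m - (x - 2 ^ m)) (2 ^ m - y) (by linarith) (by linarith) (by linarith)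
        rw [lexBoundary_two_pow_sub, lexBoundary_two_pow_sub,
          show (2 : ℤ) ^ m - (x - 2 ^ m) + (2 ^ m - y) = 2 ^ m - (x + y - 2 ^ (m + 1)) by
            rw [e]; ring, lexBoundary_two_pow_sub] at this
        rcases le_total (x + y - 2 ^ (m + 1)) (2 ^ m) with h' | h'
        · rw [lexBoundary_succ_of_ge h, lexBoundary_succ_of_le h']
          linarith [this]
        · have hx2 : x = 2 ^ (m + 1) := by linarith
          have hy2 : y = 2 ^ m := by linarith
          rw [lexBoundary_succ_of_ge h, lexBoundary_succ_of_le (by linarith)]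
          linarith [this]
    refine ⟨fun x y hx hx' hy hy' => ?_, fun x y hx hy hxy => ?_⟩
    · rcases le_total x (2 ^ m) with h | h <;> rcases le_total y (2 ^ m) with h' | h'
      · rw [lexBoundary_succ_of_le (by linarith : x + y ≤ 2 ^ (m + 1)), lexBoundary_succ_of_le h,
          lexBoundary_succ_of_le h']
        linarith [merge x y hx h hy h']
      · rw [add_comm x y, abs_sub_comm, add_comm (lexBoundary (m + 1) x)]
        exact mixed y x h' hy' hx h
      · exact mixed x y h hx' hy h'
      · rw [lexBoundary_succ_of_ge (by linarith : 2 ^ (m + 1) ≤ x + y), lexBoundary_succ_of_ge h,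
          lexBoundary_succ_of_ge h', show x + y - 2 ^ (m + 1) = (x - 2 ^ m) + (y - 2 ^ m) by
            rw [e]; ring]
        have := merge (x - 2 ^ m) (y - 2 ^ m) (by linarith) (by linarith) (by linarith)
          (by linarith)
        rw [show x - 2 ^ m - (y - 2 ^ m) = x - y by ring] at this
        linarith
    · rcases le_total x (2 ^ m) with h | h <;> rcases le_total y (2 ^ m) with h' | h'
      · rw [lexBoundary_succ_of_le h, lexBoundary_succ_of_le h']
        have := merge x y hx h hy h'
        have : |x - y| ≤ x + y := abs_le.2 ⟨by linarith, by linarith⟩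
        linarith
      · rw [lexBoundary_succ_of_le h, lexBoundary_succ_of_ge h',
          lexBoundary_succ_of_ge (by linarith : 2 ^ m ≤ x + y), add_sub_assoc]
        linarith [subadd x (y - 2 ^ m) hx (by linarith) (by linarith)]
      · rw [lexBoundary_succ_of_ge h, lexBoundary_succ_of_le h',
          lexBoundary_succ_of_ge (by linarith : 2 ^ m ≤ x + y),
          show x + y - 2 ^ m = (x - 2 ^ m) + y by ring]
        linarith [subadd (x - 2 ^ m) y (by linarith) hy (by linarith)]
      · have hx2 : x = 2 ^ m := by linarith
        have hy2 : y = 2 ^ m := by linarith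
        rw [hx2, hy2, ← two_mul, ← e, lexBoundary_two_pow, lexBoundary_succ_of_le le_rfl,
          lexBoundary_two_pow]
        have : (0 : ℤ) < 2 ^ m := by positivity
        linarith

lemma two_mul_sum_range_cast (q : ℕ) : 2 * ∑ j ∈ range q, (j : ℤ) = q * (q - 1) := by
  induction q with
  | zero => simp
  | succ q ih => rw [sum_range_succ, mul_add, ih]; push_cast; ring

lemma sum_range_lexBoundary_of_le {m q : ℕ} (h : q ≤ 2 ^ m) :
    2 * ∑ j ∈ range q, lexBoundary (m + 1) j =
      q * (q - 1) + 2 * ∑ j ∈ range q, lexBoundary m j := by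
  rw [← two_mul_sum_range_cast, ← mul_add, ← sum_add_distrib]
  congr 1
  refine sum_congr rfl fun j hj => lexBoundary_succ_of_le ?_
  exact_mod_cast (mem_range.1 hj).le.trans h

lemma sum_range_lexBoundary_two_pow_add (m z : ℕ) :
    2 * ∑ j ∈ range (2 ^ m + z), lexBoundary (m + 1) j =
      2 * ∑ j ∈ range (2 ^ m), lexBoundary (m + 1) j +
        2 * z * 2 ^ m - z * (z - 1) + 2 * ∑ j ∈ range z, lexBoundary m j := by
  have h : ∑ j ∈ range z, lexBoundary (m + 1) ((2 ^ m + j : ℕ) : ℤ) =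
      z * 2 ^ m - ∑ j ∈ range z, (j : ℤ) + ∑ j ∈ range z, lexBoundary m j := by
    have hc : (z : ℤ) * 2 ^ m = ∑ _j ∈ range z, 2 ^ m := by simp
    rw [hc, ← sum_sub_distrib, ← sum_add_distrib]
    refine sum_congr rfl fun j _ => ?_
    push_cast
    rw [lexBoundary_succ_of_ge (by linarith [Nat.cast_nonneg (α := ℤ) j]), add_sub_cancel_left]
    ring
  rw [sum_range_add, mul_add, h, ← two_mul_sum_range_cast]
  ring

lemma sum_range_two_pow_lexBoundary (m : ℕ) :
    2 * ∑ j ∈ range (2 ^ m), lexBoundary m j = 2 ^ m * (2 ^ m - 1) := by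
  induction m with
  | zero => simp [lexBoundary]
  | succ m ih =>
    rw [pow_succ, mul_two, sum_range_lexBoundary_two_pow_add, sum_range_lexBoundary_of_le le_rfl,
      ih]
    push_cast
    ring

/-- The profile at `q ≤ 2 ^ m` controls its average over smaller arguments. -/
lemma two_mul_sum_range_lexBoundary_le (m q : ℕ) (h : q ≤ 2 ^ m) :
    2 * ∑ j ∈ range q, lexBoundary m j ≤ q ^ 2 + (2 * q - 1) * lexBoundary m q := by
  induction m generalizing q with
  | zero => simp [lexBoundary]
  | succ m ih =>
    rcases le_total q (2 ^ m) with hq | hq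
    · have := ih q hq
      rw [sum_range_lexBoundary_of_le hq, lexBoundary_succ_of_le (by exact_mod_cast hq)]
      nlinarith [sq_nonneg (q : ℤ)]
    · obtain ⟨z, rfl⟩ := Nat.exists_eq_add_of_le hq
      have hz : z ≤ 2 ^ m := by rw [pow_succ] at h; omega
      have hz' : (z : ℤ) ≤ 2 ^ m := by exact_mod_cast hz
      have hH := lexBoundary_nonneg m (Nat.cast_nonneg z) hz'
      have := ih z hz
      rw [sum_range_lexBoundary_two_pow_add, sum_range_lexBoundary_of_le le_rfl,
        sum_range_two_pow_lexBoundary,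
        lexBoundary_succ_of_ge (by push_cast; linarith [Nat.cast_nonneg (α := ℤ) z])]
      push_cast
      rw [add_sub_cancel_left, pow_succ (2 : ℤ) m]
      have hQ : (0 : ℤ) < 2 ^ m := by positivity
      generalize (2 : ℤ) ^ m = Q at *
      have h1 : 0 ≤ Q * lexBoundary m z := by positivity
      have h2 : (z : ℤ) ^ 2 ≤ Q ^ 2 := by
        have : (0 : ℤ) ≤ z := Nat.cast_nonneg z
        gcongr
      nlinarith

/-- Negate the coordinate `k`. -/
def flipBit {n : ℕ} (k : Fin n) (v : Fin n → Bool) : Fin n → Bool :=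
  Function.update v k (!v k)

lemma flipBit_flipBit {n : ℕ} (k : Fin n) (v : Fin n → Bool) : flipBit k (flipBit k v) = v := by
  simp [flipBit]

/-- Negation of a coordinate as a permutation of the cube. -/
def flipBitPerm {n : ℕ} (k : Fin n) : Equiv.Perm (Fin n → Bool) where
  toFun := flipBit k
  invFun := flipBit k
  left_inv := flipBit_flipBit k
  right_inv := flipBit_flipBit k

lemma sum_comp_flipBit {n : ℕ} {M : Type*} [AddCommMonoid M] (k : Fin n)
    (φ : (Fin n → Bool) → M) : ∑ v, φ (flipBit k v) = ∑ v, φ v :=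
  Equiv.sum_comp (flipBitPerm k) φ

lemma cubeAdj_iff_exists_flipBit {n : ℕ} {u v : Fin n → Bool} :
    cubeAdj u v ↔ ∃ k, v = flipBit k u := by
  unfold cubeAdj diffCount
  rw [card_eq_one]
  refine exists_congr fun k => ?_
  rw [Finset.ext_iff]
  simp only [mem_filter, mem_univ, true_and, mem_singleton, flipBit, funext_iff,
    Function.update_apply]
  refine forall_congr' fun i => ?_
  by_cases h : i = k
  · subst h
    cases u i <;> cases v i <;> simp
  · simp [h, eq_comm]

lemma flipBit_left_injective {n : ℕ} (v : Fin n → Bool) :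
    Function.Injective fun k => flipBit k v := by
  intro k l h
  by_contra hkl
  have := congrFun h k
  simp [flipBit, hkl] at this

lemma theta_eq_sum (n : ℕ) (S : Finset (Fin n → Bool)) :
    (theta n S : ℤ) = ∑ k, ∑ v, if v ∈ S ∧ flipBit k v ∉ S then 1 else 0 := by
  have h : theta n S = (((univ : Finset (Fin n)) ×ˢ univ).filter
      fun p : Fin n × (Fin n → Bool) => p.2 ∈ S ∧ flipBit p.1 p.2 ∉ S).card := by
    symm
    refine card_bij (fun p _ => (p.2, flipBit p.1 p.2)) ?_ ?_ ?_
    · rintro ⟨k, v⟩ h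
      simp only [mem_filter, mem_product, mem_univ, true_and] at h ⊢
      exact ⟨h.1, h.2, cubeAdj_iff_exists_flipBit.2 ⟨k, rfl⟩⟩
    · rintro ⟨k, v⟩ - ⟨l, w⟩ - h
      obtain ⟨rfl, h⟩ := Prod.mk.inj h
      exact Prod.ext (flipBit_left_injective v h) rfl
    · rintro ⟨u, v⟩ h
      simp only [mem_filter, mem_product, mem_univ, true_and] at h
      obtain ⟨k, rfl⟩ := cubeAdj_iff_exists_flipBit.1 h.2.2
      exact ⟨(k, u), by simpa using ⟨h.1, h.2.1⟩, rfl⟩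
  rw [h, card_filter, sum_product]
  push_cast
  rfl

lemma two_mul_theta_eq_sum (n : ℕ) (S : Finset (Fin n → Bool)) :
    2 * (theta n S : ℤ) = ∑ k, ∑ v, if (v ∈ S ↔ flipBit k v ∈ S) then 0 else 1 := by
  have h : ∀ k : Fin n, ∑ v, (if v ∈ S ∧ flipBit k v ∉ S then (1 : ℤ) else 0) =
      ∑ v, if flipBit k v ∈ S ∧ v ∉ S then 1 else 0 := fun k => by
    rw [← sum_comp_flipBit k]
    simp only [flipBit_flipBit]
  rw [two_mul]
  nth_rw 2 [theta_eq_sum]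
  simp_rw [h]
  rw [theta_eq_sum, ← sum_add_distrib]
  simp_rw [← sum_add_distrib]
  refine sum_congr rfl fun k _ => sum_congr rfl fun v _ => ?_
  by_cases h₁ : v ∈ S <;> by_cases h₂ : flipBit k v ∈ S <;> simp [h₁, h₂]

/-- Insert the bit `b` at position `k`. -/
abbrev insertBit {n : ℕ} (k : Fin (n + 1)) (b : Bool) (w : Fin n → Bool) : Fin (n + 1) → Bool :=
  Fin.insertNth (α := fun _ => Bool) k b w

lemma flipBit_insertBit {n : ℕ} (k : Fin (n + 1)) (b : Bool) (w : Fin n → Bool) :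
    flipBit k (insertBit k b w) = insertBit k (!b) w := by
  simp [flipBit, insertBit]

lemma flipBit_succAbove_insertBit {n : ℕ} (k : Fin (n + 1)) (j : Fin n) (b : Bool)
    (w : Fin n → Bool) :
    flipBit (k.succAbove j) (insertBit k b w) = insertBit k b (flipBit j w) := by
  ext i
  refine Fin.succAboveCases k ?_ (fun i => ?_) i
  · simp [flipBit, insertBit, (Fin.succAbove_ne k j).symm]
  · simp [flipBit, insertBit, Function.update_apply]

lemma sum_eq_sum_insertBit {n : ℕ} {M : Type*} [AddCommMonoid M] (k : Fin (n + 1))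
    (φ : (Fin (n + 1) → Bool) → M) :
    ∑ v, φ v = ∑ w, (φ (insertBit k true w) + φ (insertBit k false w)) := by
  rw [← (Fin.insertNthEquiv (fun _ => Bool) k).sum_comp φ, Fintype.sum_prod_type,
    Fintype.sum_bool, ← sum_add_distrib]
  rfl

lemma sum_flipBit_eq_sum_insertBit {n : ℕ} {M : Type*} [AddCommMonoid M] (k : Fin (n + 1))
    (φ : (Fin (n + 1) → Bool) → (Fin (n + 1) → Bool) → M) :
    ∑ j, ∑ v, φ v (flipBit j v) =
      ∑ w, (φ (insertBit k true w) (insertBit k false w) +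
          φ (insertBit k false w) (insertBit k true w)) +
        (∑ j, ∑ w, φ (insertBit k true w) (insertBit k true (flipBit j w)) +
          ∑ j, ∑ w, φ (insertBit k false w) (insertBit k false (flipBit j w))) := by
  rw [Fin.sum_univ_succAbove _ k]
  simp_rw [sum_eq_sum_insertBit k, flipBit_succAbove_insertBit, flipBit_insertBit,
    sum_add_distrib, Bool.not_true, Bool.not_false]

/-- The section of `S` where coordinate `k` equals `b`. -/
def cubeSection {n : ℕ} (k : Fin (n + 1)) (b : Bool) (S : Finset (Fin (n + 1) → Bool)) :
    Finset (Fin n → Bool) :=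
  univ.filter fun w => insertBit k b w ∈ S

lemma card_cubeSection_add {n : ℕ} (k : Fin (n + 1)) (S : Finset (Fin (n + 1) → Bool)) :
    (cubeSection k true S).card + (cubeSection k false S).card = S.card := by
  have : S.card = ∑ v, if v ∈ S then 1 else 0 := by simp
  rw [this, sum_eq_sum_insertBit k, sum_add_distrib]
  simp [cubeSection]

lemma abs_card_cubeSection_sub_add_theta_le {n : ℕ} (k : Fin (n + 1))
    (S : Finset (Fin (n + 1) → Bool)) :
    |((cubeSection k true S).card : ℤ) - (cubeSection k false S).card| +
      (theta n (cubeSection k true S) + theta n (cubeSection k false S)) ≤ theta (n + 1) S := by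
  rw [theta_eq_sum, theta_eq_sum, theta_eq_sum, sum_flipBit_eq_sum_insertBit k
    (fun u v => if u ∈ S ∧ v ∉ S then (1 : ℤ) else 0)]
  simp only [cubeSection, mem_filter, mem_univ, true_and]
  gcongr
  have hc : ∀ T : Finset (Fin n → Bool), (T.card : ℤ) = ∑ w, if w ∈ T then 1 else 0 := by simp
  rw [hc, hc, ← sum_sub_distrib]
  refine (abs_sum_le_sum_abs _ _).trans (sum_le_sum fun w _ => ?_)
  simp only [mem_filter, mem_univ, true_and]
  split_ifs <;> simp_all

/-- The edge-isoperimetric inequality in the hypercube. -/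
lemma lexBoundary_le_theta (n : ℕ) (S : Finset (Fin n → Bool)) :
    lexBoundary n S.card ≤ theta n S := by
  induction n with
  | zero => exact Int.natCast_nonneg _
  | succ n ih =>
    have hcard : ∀ T : Finset (Fin n → Bool), (T.card : ℤ) ≤ 2 ^ n := fun T => by
      exact_mod_cast T.card_le_univ.trans (by simp)
    have h := (lexBoundary_merge_and_subadditive n).1 (cubeSection 0 true S).card
      (cubeSection 0 false S).card (by positivity) (hcard _) (by positivity) (hcard _)
    rw [← Nat.cast_add, card_cubeSection_add] at h
    linarith [abs_card_cubeSection_sub_add_theta_le 0 S, ih (cubeSection 0 true S),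
      ih (cubeSection 0 false S)]

/-- A lower bound for the boundary of a set of half the vertices, in terms of the size of one
section. -/
lemma lexBoundary_le_theta_of_card_eq {n : ℕ} (k : Fin (n + 1))
    {S : Finset (Fin (n + 1) → Bool)} (hS : S.card = 2 ^ n) :
    2 * lexBoundary n (cubeSection k false S).card +
        |2 ^ n - 2 * ((cubeSection k false S).card : ℤ)| ≤
      theta (n + 1) S := by
  have h := abs_card_cubeSection_sub_add_theta_le k S
  have hc : ((cubeSection k true S).card : ℤ) = 2 ^ n - (cubeSection k false S).card := by
    rw [eq_sub_iff_add_eq]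
    exact_mod_cast (card_cubeSection_add k S).trans hS
  have h₁ := lexBoundary_le_theta n (cubeSection k true S)
  have h₂ := lexBoundary_le_theta n (cubeSection k false S)
  rw [hc, lexBoundary_two_pow_sub] at h₁
  rw [hc, sub_sub, ← two_mul] at h
  linarith

/-- The first-level Fourier coefficient of `f` at coordinate `k`, scaled by `2 ^ n`. -/
def levelOne {n : ℕ} (f : (Fin n → Bool) → ℤ) (k : Fin n) : ℤ :=
  ∑ v, (if v k then 1 else -1) * f v

lemma levelOne_zero_eq {n : ℕ} (f : (Fin (n + 1) → Bool) → ℤ) :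
    levelOne f 0 = ∑ w, f (insertBit 0 true w) - ∑ w, f (insertBit 0 false w) := by
  rw [levelOne, sum_eq_sum_insertBit 0, ← sum_sub_distrib]
  refine sum_congr rfl fun w _ => ?_
  simp [insertBit]
  ring

lemma levelOne_succ_eq {n : ℕ} (f : (Fin (n + 1) → Bool) → ℤ) (k : Fin n) :
    levelOne f k.succ = levelOne (fun w => f (insertBit 0 true w)) k +
      levelOne (fun w => f (insertBit 0 false w)) k := by
  rw [levelOne, sum_eq_sum_insertBit 0, sum_add_distrib]
  simp [levelOne, insertBit]

/-- Bessel's inequality for the characters of degree at most one. -/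
lemma sum_sq_levelOne_add_sq_sum_le {n : ℕ} (f : (Fin n → Bool) → ℤ) :
    ∑ k, levelOne f k ^ 2 + (∑ v, f v) ^ 2 ≤ 2 ^ n * ∑ v, f v ^ 2 := by
  induction n with
  | zero => simp
  | succ n ih =>
    have h₁ := ih fun w => f (insertBit 0 true w)
    have h₀ := ih fun w => f (insertBit 0 false w)
    have h : ∑ k : Fin n, levelOne f k.succ ^ 2 ≤
        2 * ∑ k, levelOne (fun w => f (insertBit 0 true w)) k ^ 2 +
          2 * ∑ k, levelOne (fun w => f (insertBit 0 false w)) k ^ 2 := by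
      rw [mul_sum, mul_sum, ← sum_add_distrib]
      refine sum_le_sum fun k _ => ?_
      rw [levelOne_succ_eq]
      nlinarith [sq_nonneg (levelOne (fun w => f (insertBit 0 true w)) k -
        levelOne (fun w => f (insertBit 0 false w)) k)]
    rw [Fin.sum_univ_succ, levelOne_zero_eq, sum_eq_sum_insertBit 0 f,
      sum_eq_sum_insertBit 0 (fun v => f v ^ 2), sum_add_distrib, sum_add_distrib,
      pow_succ (2 : ℤ) n]
    nlinarith

/-- The spectral gap of the hypercube above the characters of degree at most one. -/
lemma eight_mul_sum_sq_le {n : ℕ} (f : (Fin n → Bool) → ℤ) :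
    8 * 2 ^ n * ∑ v, f v ^ 2 ≤ 2 ^ n * ∑ k, ∑ v, (f v - f (flipBit k v)) ^ 2 +
      4 * ∑ k, levelOne f k ^ 2 + 8 * (∑ v, f v) ^ 2 := by
  induction n with
  | zero => simp
  | succ n ih =>
    have h₁ := ih fun w => f (insertBit 0 true w)
    have h₀ := ih fun w => f (insertBit 0 false w)
    have hB := sum_sq_levelOne_add_sq_sum_le
      fun w : Fin n → Bool => f (insertBit 0 true w) - f (insertBit 0 false w)
    have hsub : ∀ k, levelOne (fun w => f (insertBit 0 true w) - f (insertBit 0 false w)) k =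
        levelOne (fun w => f (insertBit 0 true w)) k -
          levelOne (fun w => f (insertBit 0 false w)) k := fun k => by
      simp only [levelOne, ← sum_sub_distrib, mul_sub]
    have h : ∑ k : Fin n, levelOne f k.succ ^ 2 =
        2 * ∑ k, levelOne (fun w => f (insertBit 0 true w)) k ^ 2 +
          2 * ∑ k, levelOne (fun w => f (insertBit 0 false w)) k ^ 2 -
            ∑ k, levelOne (fun w => f (insertBit 0 true w) - f (insertBit 0 false w)) k ^ 2 := by
      rw [mul_sum, mul_sum, ← sum_add_distrib, ← sum_sub_distrib]
      refine sum_congr rfl fun k _ => ?_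
      rw [levelOne_succ_eq, hsub]
      ring
    have hcross : ∑ w : Fin n → Bool, ((f (insertBit 0 true w) - f (insertBit 0 false w)) ^ 2 +
          (f (insertBit 0 false w) - f (insertBit 0 true w)) ^ 2) =
        2 * ∑ w : Fin n → Bool, (f (insertBit 0 true w) - f (insertBit 0 false w)) ^ 2 := by
      rw [mul_sum]
      exact sum_congr rfl fun w _ => by ring
    rw [sum_sub_distrib] at hB
    rw [sum_flipBit_eq_sum_insertBit 0 (fun u v => (f u - f v) ^ 2), hcross,
      Fin.sum_univ_succ (fun k => levelOne f k ^ 2), h, levelOne_zero_eq,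
      sum_eq_sum_insertBit 0 f, sum_eq_sum_insertBit 0 (fun v => f v ^ 2), sum_add_distrib,
      sum_add_distrib, pow_succ (2 : ℤ) n]
    nlinarith

lemma two_mul_levelOne {n : ℕ} (f : (Fin n → Bool) → ℤ) (k : Fin n) :
    2 * levelOne f k = ∑ v, (if v k then 1 else -1) * (f v - f (flipBit k v)) := by
  have h : ∑ v, (if v k then 1 else -1) * f (flipBit k v) = -levelOne f k := by
    rw [levelOne, ← sum_neg_distrib, ← sum_comp_flipBit k]
    refine sum_congr rfl fun v _ => ?_
    rw [flipBit_flipBit]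
    cases hv : v k <;> simp [flipBit, hv]
  simp_rw [mul_sub]
  rw [sum_sub_distrib, h, levelOne]
  ring

/-- The `±1`-valued indicator function of `S`. -/
def signIndicator {n : ℕ} (S : Finset (Fin n → Bool)) (v : Fin n → Bool) : ℤ :=
  if v ∈ S then 1 else -1

lemma sum_abs_levelOne_le {n : ℕ} (S : Finset (Fin n → Bool)) :
    ∑ k, |levelOne (signIndicator S) k| ≤ 2 * theta n S := by
  rw [two_mul_theta_eq_sum]
  refine sum_le_sum fun k _ => ?_
  have h := abs_sum_le_sum_abs (fun v : Fin n → Bool => (if v k then 1 else -1) *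
    (signIndicator S v - signIndicator S (flipBit k v))) univ
  rw [← two_mul_levelOne, abs_mul, abs_two] at h
  have h' : ∑ v, |(if v k then 1 else -1) * (signIndicator S v - signIndicator S (flipBit k v))| =
      2 * ∑ v, if (v ∈ S ↔ flipBit k v ∈ S) then (0 : ℤ) else 1 := by
    rw [mul_sum]
    refine sum_congr rfl fun v _ => ?_
    rw [abs_mul, signIndicator, signIndicator]
    by_cases h₁ : v ∈ S <;> by_cases h₂ : flipBit k v ∈ S <;> by_cases h₃ : v k = true <;>
      simp [h₁, h₂, h₃]
  linarith

lemma sum_sq_signIndicator_sub {n : ℕ} (S : Finset (Fin n → Bool)) :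
    ∑ k, ∑ v, (signIndicator S v - signIndicator S (flipBit k v)) ^ 2 = 8 * theta n S := by
  rw [show (8 : ℤ) * theta n S = 4 * (2 * theta n S) by ring, two_mul_theta_eq_sum, mul_sum]
  simp_rw [mul_sum]
  refine sum_congr rfl fun k _ => sum_congr rfl fun v _ => ?_
  rw [signIndicator, signIndicator]
  by_cases h₁ : v ∈ S <;> by_cases h₂ : flipBit k v ∈ S <;> simp [h₁, h₂]

lemma sum_signIndicator {n : ℕ} (S : Finset (Fin n → Bool)) :
    ∑ v, signIndicator S v = 2 * S.card - 2 ^ n := by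
  have h : ∀ v, signIndicator S v = 2 * (if v ∈ S then 1 else 0) - 1 := fun v => by
    rw [signIndicator]
    split_ifs <;> rfl
  simp_rw [h, sum_sub_distrib, ← mul_sum]
  simp

lemma levelOne_signIndicator {n : ℕ} (k : Fin (n + 1)) {S : Finset (Fin (n + 1) → Bool)}
    (hS : S.card = 2 ^ n) :
    levelOne (signIndicator S) k = 2 * (2 ^ n - 2 * (cubeSection k false S).card) := by
  have hc : ((cubeSection k true S).card : ℤ) = 2 ^ n - (cubeSection k false S).card := by
    rw [eq_sub_iff_add_eq]
    exact_mod_cast (card_cubeSection_add k S).trans hS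
  have h : ∀ b w, signIndicator S (insertBit k b w) = signIndicator (cubeSection k b S) w :=
    fun b w => by simp [signIndicator, cubeSection]
  rw [levelOne, sum_eq_sum_insertBit k]
  simp only [insertBit, Fin.insertNth_apply_same, if_true, Bool.false_eq_true, if_false]
  simp only [← insertBit.eq_def, h, one_mul, neg_one_mul, sum_add_distrib, sum_neg_distrib,
    sum_signIndicator, hc]
  ring

/-- A half-size set without influential coordinates has a large boundary. -/
lemma three_mul_two_pow_le_of_balanced {n : ℕ} {S : Finset (Fin (n + 1) → Bool)}
    (hS : S.card = 2 ^ n)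
    (h : ∀ k, 4 * |2 ^ n - 2 * ((cubeSection k false S).card : ℤ)| ≤ 2 ^ n) :
    3 * 2 ^ n ≤ 2 * (theta (n + 1) S : ℤ) := by
  have hP : (0 : ℤ) < 2 ^ n := by positivity
  have hgap := eight_mul_sum_sq_le (signIndicator S)
  have hsq : ∑ v, signIndicator S v ^ 2 = 2 * 2 ^ n := by
    have : ∀ v, signIndicator S v ^ 2 = 1 := fun v => by
      rw [signIndicator]
      split_ifs <;> rfl
    simp [this, pow_succ, mul_comm]
  have hsum : ∑ v, signIndicator S v = 0 := by
    rw [sum_signIndicator, hS]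
    push_cast
    ring
  have hlevel : 2 * ∑ k, levelOne (signIndicator S) k ^ 2 ≤ 2 ^ n * (2 * theta (n + 1) S) := by
    refine le_trans ?_ (mul_le_mul_of_nonneg_left (sum_abs_levelOne_le S) hP.le)
    rw [mul_sum, mul_sum]
    refine sum_le_sum fun k _ => ?_
    have hk : 2 * |levelOne (signIndicator S) k| ≤ 2 ^ n := by
      rw [levelOne_signIndicator k hS, abs_mul, abs_two]
      linarith [h k]
    rw [← sq_abs]
    nlinarith [abs_nonneg (levelOne (signIndicator S) k)]
  rw [hsq, sum_sq_signIndicator_sub, hsum, pow_succ] at hgap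
  have : 2 ^ n * (8 * 2 ^ n) ≤ 2 ^ n * (5 * (theta (n + 1) S : ℤ)) := by nlinarith
  linarith [le_of_mul_le_mul_left this hP]

lemma three_mul_two_pow_le_lexBoundary {n : ℕ} {a : ℤ} (h₁ : 2 * 2 ^ n ≤ a)
    (h₂ : a ≤ 3 * 2 ^ n) :
    3 * 2 ^ (n + 3) ≤ 2 * (2 * lexBoundary (n + 3) a + |2 ^ (n + 3) - 2 * a|) := by
  have e₁ : (2 : ℤ) ^ (n + 1) = 2 * 2 ^ n := by ring
  have e₂ : (2 : ℤ) ^ (n + 2) = 4 * 2 ^ n := by ring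
  have e₃ : (2 : ℤ) ^ (n + 3) = 8 * 2 ^ n := by ring
  have hP : (0 : ℤ) < 2 ^ n := by positivity
  have h := lexBoundary_nonneg n (a := a - 2 ^ (n + 1)) (by linarith) (by linarith)
  rw [lexBoundary_succ_of_le (by linarith), lexBoundary_succ_of_ge (by linarith),
    lexBoundary_succ_of_le (by linarith), abs_of_nonneg (by linarith)]
  linarith

/-- A half-size set either has a large boundary or is close to a facet. -/
lemma three_mul_two_pow_le_or_exists {n : ℕ} {S : Finset (Fin (n + 3 + 1) → Bool)}
    (hS : S.card = 2 ^ (n + 3)) :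
    3 * 2 ^ (n + 3) ≤ 2 * (theta (n + 3 + 1) S : ℤ) ∨
      ∃ k, ((cubeSection k false S).card : ℤ) ≤ 2 * 2 ^ n ∨
        6 * 2 ^ n ≤ ((cubeSection k false S).card : ℤ) := by
  by_contra! hcon
  obtain ⟨hθ, hsec⟩ := hcon
  have e₃ : (2 : ℤ) ^ (n + 3) = 8 * 2 ^ n := by ring
  refine hθ.not_ge (three_mul_two_pow_le_of_balanced hS fun k => ?_)
  obtain ⟨hl, hr⟩ := hsec k
  have hk := lexBoundary_le_theta_of_card_eq k hS
  by_contra! hlarge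
  rcases lt_abs.1 (show 2 ^ (n + 3) < |4 * (2 ^ (n + 3) - 2 * ((cubeSection k false S).card : ℤ))|
    by rwa [abs_mul, abs_of_nonneg (by norm_num : (0 : ℤ) ≤ 4)]) with h | h
  · have := three_mul_two_pow_le_lexBoundary (n := n) (a := (cubeSection k false S).card)
      (by linarith) (by linarith)
    linarith
  · have := three_mul_two_pow_le_lexBoundary (n := n)
      (a := 2 ^ (n + 3) - (cubeSection k false S).card) (by linarith) (by linarith)
    rw [lexBoundary_two_pow_sub, abs_sub_comm, show (2 * (2 ^ (n + 3) -
      ((cubeSection k false S).card : ℤ)) - 2 ^ (n + 3)) =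
        2 ^ (n + 3) - 2 * ((cubeSection k false S).card : ℤ) by ring] at this
    linarith

lemma sum_range_ite_lt_iff_lt {P α β : ℕ} (hα : α ≤ P) (hβ : β ≤ P) :
    ∑ t ∈ range P, (if (t < α ↔ t < β) then 0 else 1) = Nat.dist α β := by
  have h : ((range P).filter fun t => ¬ (t < α ↔ t < β)) = Ico (min α β) (max α β) := by
    ext t
    simp only [mem_filter, mem_range, mem_Ico]
    omega
  have hd : Nat.dist α β = (Ico (min α β) (max α β)).card := by
    rw [Nat.card_Ico, Nat.dist]
    omega
  rw [hd, ← h, card_filter]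
  exact sum_congr rfl fun t _ => by split_ifs <;> rfl

lemma sum_range_ite_lt_iff_not_lt {P α β : ℕ} (hα : α ≤ P) (hβ : β ≤ P) :
    ∑ t ∈ range P, (if (t < α ↔ ¬ t < β) then 0 else 1) = P - Nat.dist α β := by
  rw [← sum_range_ite_lt_iff_lt hα hβ, eq_tsub_iff_add_eq_of_le, ← sum_add_distrib]
  · rw [sum_congr rfl fun t _ => ?_, sum_const, card_range, nsmul_one, Nat.cast_id]
    by_cases h₁ : t < α <;> by_cases h₂ : t < β <;> simp [h₁, h₂]
  · rw [sum_range_ite_lt_iff_lt hα hβ, Nat.dist]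
    omega

lemma sum_range_ite_mod_lt {P x y : ℕ} (hx : x < 2 * P) (hy : y < 2 * P) :
    ∑ t ∈ range P, (if ((x + t) % (2 * P) < P ↔ (y + t) % (2 * P) < P) then 0 else 1) =
      cycDist (2 * P) x y := by
  have low : ∀ z t, z < P → t < P → ((z + t) % (2 * P) < P ↔ t < P - z) := fun z t hz ht => by
    rw [Nat.mod_eq_of_lt (by omega)]
    omega
  have high : ∀ z t, P ≤ z → z < 2 * P → t < P →
      ((z + t) % (2 * P) < P ↔ ¬ t < 2 * P - z) := fun z t hz hz' ht => by
    rcases lt_or_ge (z + t) (2 * P) with h | h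
    · rw [Nat.mod_eq_of_lt h]
      omega
    · rw [Nat.mod_eq_sub_mod h, Nat.mod_eq_of_lt (by omega)]
      omega
  rw [cycDist]
  rcases lt_or_ge x P with h | h <;> rcases lt_or_ge y P with h' | h'
  · rw [sum_congr rfl fun t ht => if_congr
      (iff_congr (low x t h (mem_range.1 ht)) (low y t h' (mem_range.1 ht))) rfl rfl,
      sum_range_ite_lt_iff_lt (by omega) (by omega)]
    simp only [Nat.dist]
    omega
  · rw [sum_congr rfl fun t ht => if_congr
      (iff_congr (low x t h (mem_range.1 ht)) (high y t h' hy (mem_range.1 ht))) rfl rfl,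
      sum_range_ite_lt_iff_not_lt (by omega) (by omega)]
    simp only [Nat.dist]
    omega
  · rw [sum_congr rfl fun t ht => if_congr
      ((iff_congr (high x t h hx (mem_range.1 ht)) (low y t h' (mem_range.1 ht))).trans iff_comm)
      rfl rfl,
      sum_range_ite_lt_iff_not_lt (by omega) (by omega)]
    simp only [Nat.dist]
    omega
  · rw [sum_congr rfl fun t ht => if_congr
      ((iff_congr (high x t h hx (mem_range.1 ht))
        (high y t h' hy (mem_range.1 ht))).trans not_iff_not) rfl rfl,
      sum_range_ite_lt_iff_lt (by omega) (by omega)]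
    simp only [Nat.dist]
    omega

/-- A discrete intermediate value theorem. -/
lemma exists_eq_of_step_le_one {b : ℕ → ℤ} (hb : ∀ t, b (t + 1) ≤ b t + 1) {l : ℤ} {N : ℕ}
    (h₀ : b 0 ≤ l) (hN : l ≤ b N) : ∃ t ≤ N, b t = l := by
  induction N with
  | zero => exact ⟨0, le_rfl, le_antisymm h₀ hN⟩
  | succ N ih =>
    rcases le_or_gt l (b N) with h | h
    · obtain ⟨t, ht, e⟩ := ih h
      exact ⟨t, ht.trans N.le_succ, e⟩
    · exact ⟨N + 1, le_rfl, by linarith [hb N, Int.add_one_le_iff.2 h]⟩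

/-- A walk from `e` to `P - e` in `P` steps visits every intermediate level, which leaves `2 * e`
times for the global lower bound `J`. -/
lemma sum_Ico_add_le_sum_range {P e : ℕ} {b θ : ℕ → ℤ} {g : ℤ → ℤ} {J : ℤ} (he : 2 * e ≤ P)
    (hb : ∀ t, b (t + 1) ≤ b t + 1) (h₀ : b 0 = e) (hP : b P = P - e)
    (hJ : ∀ t, J ≤ θ t) (hg : ∀ t, g (b t) ≤ θ t) :
    ∑ l ∈ Ico e (P - e), g l + 2 * e * J ≤ ∑ t ∈ range P, θ t := by
  have hex : ∀ l ∈ Ico e (P - e), ∃ t ∈ range P, b t = l := fun l hl => by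
    rw [mem_Ico] at hl
    obtain ⟨t, ht, hbt⟩ := exists_eq_of_step_le_one hb (l := l) (N := P) (by omega) (by omega)
    refine ⟨t, mem_range.2 (lt_of_le_of_ne ht ?_), hbt⟩
    rintro rfl
    omega
  choose! τ hτ hbτ using hex
  have hinj : Set.InjOn τ (Ico e (P - e)) := fun l hl l' hl' h => by
    have := hbτ l hl
    rw [h, hbτ l' hl'] at this
    exact_mod_cast this.symm
  have key : ∑ l ∈ Ico e (P - e), (g l - J) ≤ ∑ t ∈ range P, (θ t - J) := by
    calc ∑ l ∈ Ico e (P - e), (g l - J) ≤ ∑ l ∈ Ico e (P - e), (θ (τ l) - J) :=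
          sum_le_sum fun l hl => by
            have := hg (τ l)
            rw [hbτ l hl] at this
            linarith
      _ = ∑ t ∈ (Ico e (P - e)).image τ, (θ t - J) := (sum_image (f := fun t => θ t - J) hinj).symm
      _ ≤ _ := sum_le_sum_of_subset_of_nonneg (image_subset_iff.2 hτ)
          fun t _ _ => sub_nonneg.2 (hJ t)
  rw [sum_sub_distrib, sum_sub_distrib, sum_const, sum_const, Nat.card_Ico, card_range,
    nsmul_eq_mul, nsmul_eq_mul, show P - e - e = P - 2 * e by omega, Nat.cast_sub he] at key
  push_cast at key
  linarith

/-- The lower bound for the boundary of a half-size set given the size of a section. -/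
def sectionBound (n : ℕ) (a : ℤ) : ℤ :=
  2 * lexBoundary n a + |2 ^ n - 2 * a|

lemma sectionBound_two_pow_sub (n : ℕ) (a : ℤ) :
    sectionBound n (2 ^ n - a) = sectionBound n a := by
  rw [sectionBound, lexBoundary_two_pow_sub, abs_sub_comm, sectionBound]
  ring_nf

lemma sectionBound_succ_of_le {n : ℕ} {a : ℤ} (h : a ≤ 2 ^ n) :
    sectionBound (n + 1) a = 2 ^ (n + 1) + 2 * lexBoundary n a := by
  rw [sectionBound, lexBoundary_succ_of_le h, abs_of_nonneg (by rw [pow_succ]; linarith)]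
  ring

lemma two_mul_sum_sectionBound (n : ℕ) :
    2 * ∑ l ∈ range (2 ^ (n + 1)), sectionBound (n + 1) l =
      2 ^ (n + 1) * (3 * 2 ^ (n + 1) - 2) := by
  have habs : ∀ R : ℕ, ∑ l ∈ range (R + R), |(2 * R : ℤ) - 2 * l| = 2 * R * R := fun R => by
    rw [sum_range_add, ← sum_add_distrib, sum_congr rfl fun l hl => ?_, sum_const, card_range,
      nsmul_eq_mul, mul_comm]
    have : (l : ℤ) < R := by exact_mod_cast mem_range.1 hl
    rw [abs_of_nonneg (by linarith), abs_of_nonpos (by push_cast; linarith)]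
    push_cast
    ring
  have h := habs (2 ^ n)
  rw [← two_mul (2 ^ n), ← pow_succ'] at h
  push_cast at h
  rw [← pow_succ'] at h
  simp only [sectionBound]
  rw [sum_add_distrib, ← mul_sum, h, sum_range_two_pow_lexBoundary]
  ring

/-- Near the ends, the profile exceeds its averages over the more extreme levels. -/
lemma sum_sectionBound_ends_le {n e : ℕ} (he : e ≤ 2 ^ n) :
    ∑ l ∈ range e, sectionBound (n + 2) l +
        ∑ l ∈ Ico (2 ^ (n + 2) - e) (2 ^ (n + 2)), sectionBound (n + 2) l ≤
      2 * e * sectionBound (n + 2) e := by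
  have h4 : 2 ^ (n + 2) = 4 * 2 ^ n := by ring
  have hrefl : ∑ l ∈ Ico (2 ^ (n + 2) - e) (2 ^ (n + 2)), sectionBound (n + 2) l =
      ∑ l ∈ range e, sectionBound (n + 2) ((l + 1 : ℕ) : ℤ) := by
    rw [sum_Ico_eq_sum_range, Nat.sub_sub_self (by omega), ← sum_range_reflect]
    refine sum_congr rfl fun j hj => ?_
    have := mem_range.1 hj
    rw [← sectionBound_two_pow_sub]
    congr 1
    rw [Nat.cast_add, Nat.cast_sub (by omega), Nat.cast_sub (by omega), Nat.cast_sub (by omega)]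
    push_cast
    ring
  have hshift := (sum_range_succ' (fun l : ℕ => sectionBound (n + 2) l) e).symm.trans
    (sum_range_succ (fun l : ℕ => sectionBound (n + 2) l) e)
  have he' : (e : ℤ) ≤ 2 ^ n := by exact_mod_cast he
  have hn : (2 : ℤ) ^ n ≤ 2 ^ (n + 1) := by rw [pow_succ]; linarith
  have hsum : ∑ l ∈ range e, sectionBound (n + 2) l =
      e * 2 ^ (n + 2) + 2 * ∑ l ∈ range e, lexBoundary (n + 1) l := by
    have h : ∀ l ∈ range e, sectionBound (n + 2) l =
        2 ^ (n + 2) + 2 * lexBoundary (n + 1) l := fun l hl => by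
      have : (l : ℤ) < e := by exact_mod_cast mem_range.1 hl
      exact sectionBound_succ_of_le (by linarith)
    rw [sum_congr rfl h, sum_add_distrib, ← mul_sum]
    simp
  have h0 : sectionBound (n + 2) ((0 : ℕ) : ℤ) = 2 ^ (n + 2) := by
    rw [Nat.cast_zero, sectionBound_succ_of_le (by positivity), lexBoundary_zero_right]
    ring
  have hmain := two_mul_sum_range_lexBoundary_le n e he
  have hH := sum_range_lexBoundary_of_le he
  rw [hrefl]
  rw [h0] at hshift
  have hg : sectionBound (n + 2) e = 2 ^ (n + 2) + 2 * (e + lexBoundary n e) := by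
    rw [sectionBound_succ_of_le (by linarith), lexBoundary_succ_of_le he']
  rw [hg] at hshift ⊢
  rw [hsum] at hshift ⊢
  nlinarith

lemma theta_compl {n : ℕ} (S : Finset (Fin n → Bool)) : theta n Sᶜ = theta n S := by
  have h : 2 * (theta n Sᶜ : ℤ) = 2 * theta n S := by
    rw [two_mul_theta_eq_sum, two_mul_theta_eq_sum]
    simp only [mem_compl, not_iff_not]
  omega

/-- The vertices whose label lies in the arc of length `P` starting at `-t` in the cycle of
length `2 * P`. -/
def arc {n : ℕ} (P : ℕ) (F : (Fin n → Bool) → ℕ) (t : ℕ) : Finset (Fin n → Bool) :=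
  univ.filter fun v => (F v + t) % (2 * P) < P

lemma mem_arc {n P t : ℕ} {F : (Fin n → Bool) → ℕ} {v : Fin n → Bool} :
    v ∈ arc P F t ↔ (F v + t) % (2 * P) < P := by
  simp [arc]

lemma arc_add {n P : ℕ} (hP : 0 < P) (F : (Fin n → Bool) → ℕ) (t : ℕ) :
    arc P F (t + P) = (arc P F t)ᶜ := by
  ext v
  rw [mem_compl, mem_arc, mem_arc, ← add_assoc]
  have h := Nat.mod_lt (F v + t) (by omega : 2 * P > 0)
  rw [Nat.add_mod, Nat.mod_eq_of_lt (by omega : P < 2 * P)]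
  rcases lt_or_ge ((F v + t) % (2 * P)) P with h' | h'
  · rw [Nat.mod_eq_of_lt (by omega)]
    omega
  · rw [Nat.mod_eq_sub_mod (by omega), Nat.mod_eq_of_lt (by omega)]
    omega

lemma add_mod_injective {α : Type*} {N : ℕ} {F : α → ℕ} (hF : Function.Injective F)
    (hlt : ∀ v, F v < N) (t : ℕ) : Function.Injective fun v => (F v + t) % N := by
  intro u v h
  have h' : F u ≡ F v [MOD N] := Nat.ModEq.add_right_cancel' t h
  rw [Nat.ModEq, Nat.mod_eq_of_lt (hlt u), Nat.mod_eq_of_lt (hlt v)] at h'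
  exact hF h'

lemma sum_eq_sum_range_of_injective {α M : Type*} [Fintype α] [AddCommMonoid M] {G : α → ℕ}
    (hG : Function.Injective G) (hlt : ∀ v, G v < Fintype.card α) (φ : ℕ → M) :
    ∑ v, φ (G v) = ∑ j ∈ range (Fintype.card α), φ j := by
  classical
  have h : univ.image G = range (Fintype.card α) := by
    refine eq_of_subset_of_card_le (fun j hj => ?_) ?_
    · obtain ⟨v, -, rfl⟩ := mem_image.1 hj
      exact mem_range.2 (hlt v)
    · rw [card_image_of_injective _ hG, card_range, card_univ]
  rw [← h, sum_image hG.injOn]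

lemma card_arc {n : ℕ} {F : (Fin (n + 1) → Bool) → ℕ} (hF : Function.Injective F)
    (hlt : ∀ v, F v < 2 * 2 ^ n) (t : ℕ) : (arc (2 ^ n) F t).card = 2 ^ n := by
  have hc : Fintype.card (Fin (n + 1) → Bool) = 2 * 2 ^ n := by simp [pow_succ, mul_comm]
  have hP : 0 < 2 ^ n := by positivity
  rw [arc, card_filter]
  rw [sum_eq_sum_range_of_injective (add_mod_injective hF hlt t)
    (fun v => by rw [hc]; exact Nat.mod_lt _ (by omega)) (fun j => if j < 2 ^ n then 1 else 0),
    hc, two_mul, sum_range_add, sum_congr rfl fun j hj => if_pos (mem_range.1 hj),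
    sum_congr rfl fun j _ => if_neg (by omega)]
  simp

lemma card_cubeSection_compl {n : ℕ} (k : Fin (n + 1)) (b : Bool)
    (S : Finset (Fin (n + 1) → Bool)) :
    (cubeSection k b Sᶜ).card + (cubeSection k b S).card = 2 ^ n := by
  have h : cubeSection k b Sᶜ = (cubeSection k b S)ᶜ := by
    ext w
    simp [cubeSection]
  rw [h, card_compl_add_card]
  simp

lemma card_cubeSection_arc_succ_le {n P : ℕ} {F : (Fin (n + 1) → Bool) → ℕ}
    (hF : Function.Injective F) (hlt : ∀ v, F v < 2 * P) (k : Fin (n + 1)) (t : ℕ) :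
    (cubeSection k false (arc P F (t + 1))).card ≤ (cubeSection k false (arc P F t)).card + 1 := by
  have hsub : cubeSection k false (arc P F (t + 1)) ⊆ cubeSection k false (arc P F t) ∪
      univ.filter fun w => (F (insertBit k false w) + t) % (2 * P) = 2 * P - 1 := by
    intro w hw
    simp only [cubeSection, mem_union, mem_filter, mem_univ, true_and, mem_arc] at hw ⊢
    have h := hlt (insertBit k false w)
    have h' := Nat.mod_lt (F (insertBit k false w) + t) (by omega : 2 * P > 0)
    by_contra! hcon
    rw [← add_assoc, ← Nat.mod_add_mod, Nat.mod_eq_of_lt (by omega)] at hw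
    omega
  refine (card_le_card hsub).trans ((card_union_le _ _).trans (Nat.add_le_add_left ?_ _))
  refine card_le_one.2 fun u hu v hv => ?_
  rw [mem_filter] at hu hv
  exact Fin.insertNth_right_injective (α := fun _ => Bool) (p := k) false
    (add_mod_injective hF hlt t (hu.2.trans hv.2.symm))

lemma sum_range_add_eq_of_periodic {M : Type*} [AddCommGroup M] {φ : ℕ → M} {P : ℕ}
    (h : ∀ t, φ (t + P) = φ t) (s : ℕ) :
    ∑ t ∈ range P, φ (s + t) = ∑ t ∈ range P, φ t := by
  induction s with
  | zero => simp
  | succ s ih =>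
    have := (sum_range_succ' (fun t => φ (s + t)) P).symm.trans
      (sum_range_succ (fun t => φ (s + t)) P)
    rw [h, add_zero, add_left_inj] at this
    rw [← ih, ← this]
    exact sum_congr rfl fun t _ => by rw [add_right_comm, add_assoc]

/-- The boundaries of the arcs of a circular layout, added over half a turn. -/
lemma le_two_mul_sum_theta_arc {n : ℕ} {F : (Fin (n + 3 + 1) → Bool) → ℕ}
    (hF : Function.Injective F) (hlt : ∀ v, F v < 2 * 2 ^ (n + 3)) :
    (2 ^ (n + 3) * (3 * 2 ^ (n + 3) - 2) : ℤ) ≤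
      2 * ∑ t ∈ range (2 ^ (n + 3)), (theta (n + 3 + 1) (arc (2 ^ (n + 3)) F t) : ℤ) := by
  set T := arc (2 ^ (n + 3)) F with hT
  set θ : ℕ → ℤ := fun t => theta (n + 3 + 1) (T t) with hθ
  have e₃ : (2 : ℤ) ^ (n + 3) = 8 * 2 ^ n := by ring
  have e₃' : 2 ^ (n + 3) = 8 * 2 ^ n := by ring
  have hP₀ : 0 < 2 ^ (n + 3) := by positivity
  have hper : ∀ t, θ (t + 2 ^ (n + 3)) = θ t := fun t => by
    simp only [hθ, hT, arc_add hP₀, theta_compl]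
  obtain ⟨s, hs⟩ : ∃ s, ∀ t, θ s ≤ θ t := by
    have h := Function.argmin_le (fun t => theta (n + 3 + 1) (T t))
    exact ⟨_, fun t => Nat.cast_le.2 (h t)⟩
  have hcard : ∀ t, (T t).card = 2 ^ (n + 3) := card_arc hF hlt
  have close : ∀ s, (∀ t, θ s ≤ θ t) → ∀ k, ((cubeSection k false (T s)).card : ℤ) ≤ 2 * 2 ^ n →
      2 ^ (n + 3) * (3 * 2 ^ (n + 3) - 2) ≤ 2 * ∑ t ∈ range (2 ^ (n + 3)), θ t := by
    intro s hs k hk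
    set e := (cubeSection k false (T s)).card with he
    have hk' : e ≤ 2 ^ (n + 1) := by rw [pow_succ, mul_comm]; exact_mod_cast hk
    have hk2 : 2 * e ≤ 2 ^ (n + 3) := by rw [pow_succ] at hk'; omega
    have hbound : ∀ t, sectionBound (n + 3) ((cubeSection k false (T t)).card : ℤ) ≤ θ t :=
      fun t => lexBoundary_le_theta_of_card_eq k (hcard t)
    have h := sum_Ico_add_le_sum_range (P := 2 ^ (n + 3)) (e := e)
      (b := fun t => (cubeSection k false (T (s + t))).card) (θ := fun t => θ (s + t))
      (g := sectionBound (n + 3)) (J := θ s) hk2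
      (fun t => by exact_mod_cast card_cubeSection_arc_succ_le hF hlt k (s + t)) rfl
      (by
        have := card_cubeSection_compl k false (T s)
        rw [hT, arc_add hP₀, eq_sub_iff_add_eq]
        exact_mod_cast this)
      (fun t => hs _) (fun t => hbound _)
    rw [sum_range_add_eq_of_periodic hper] at h
    have hends := sum_sectionBound_ends_le (n := n + 1) hk'
    have htotal := two_mul_sum_sectionBound (n + 2)
    rw [range_eq_Ico, ← sum_Ico_consecutive _ (Nat.zero_le e) (show e ≤ 2 ^ (n + 3) by omega),
      ← sum_Ico_consecutive _ (show e ≤ 2 ^ (n + 3) - e by omega) (Nat.sub_le _ _),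
      ← range_eq_Ico] at htotal
    have hJ := mul_le_mul_of_nonneg_left (hbound s) (by positivity : (0 : ℤ) ≤ 2 * e)
    rw [← he] at hJ
    linarith
  rcases three_mul_two_pow_le_or_exists (hcard s) with h | ⟨k, h | h⟩
  · have : ∑ _t ∈ range (2 ^ (n + 3)), θ s ≤ ∑ t ∈ range (2 ^ (n + 3)), θ t :=
      sum_le_sum fun t _ => hs t
    rw [sum_const, card_range, nsmul_eq_mul] at this
    push_cast at this
    have hP : (0 : ℤ) < 2 ^ (n + 3) := by positivity
    have := mul_le_mul_of_nonneg_left h hP.le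
    linarith
  · exact close s hs k h
  · refine close (s + 2 ^ (n + 3)) (fun t => (hper s).trans_le (hs t)) k ?_
    have := card_cubeSection_compl k false (T s)
    rw [hT, arc_add hP₀, ← hT]
    zify at this
    linarith

/-- The circular wirelength of a labelling of the hypercube. -/
lemma le_sum_cycDist {n : ℕ} {F : (Fin (n + 3 + 1) → Bool) → ℕ}
    (hF : Function.Injective F) (hlt : ∀ v, F v < 2 * 2 ^ (n + 3)) :
    (2 ^ (n + 3) * (3 * 2 ^ (n + 3) - 2) : ℤ) ≤
      ∑ k, ∑ v, (cycDist (2 * 2 ^ (n + 3)) (F v) (F (flipBit k v)) : ℤ) := by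
  refine (le_two_mul_sum_theta_arc hF hlt).trans_eq ?_
  rw [mul_sum]
  simp_rw [two_mul_theta_eq_sum, mem_arc]
  rw [sum_comm]
  refine sum_congr rfl fun k _ => ?_
  rw [sum_comm]
  refine sum_congr rfl fun v _ => ?_
  rw [← sum_range_ite_mod_lt (hlt v) (hlt _)]
  push_cast
  rfl

lemma flipBit_apply_self {n : ℕ} (k : Fin n) (v : Fin n → Bool) : flipBit k v k = !v k := by
  simp [flipBit]

lemma flipBit_apply_of_ne {n : ℕ} {j k : Fin n} (h : k ≠ j) (v : Fin n → Bool) :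
    flipBit j v k = v k := by
  simp [flipBit, h]

/-- The sum of label differences over the ordered edges induced on `B`. -/
def inducedLength {n : ℕ} (B : Finset (Fin n → Bool)) (r : (Fin n → Bool) → ℕ) : ℕ :=
  ∑ k, ∑ v, if v ∈ B ∧ flipBit k v ∈ B then Nat.dist (r v) (r (flipBit k v)) else 0

lemma card_filter_flipBit_le {n : ℕ} {B B' : Finset (Fin n → Bool)} {k : Fin n}
    (h : ∀ v ∈ B, flipBit k v ∈ B → v ∈ B' ∨ flipBit k v ∈ B') :
    (univ.filter fun v => v ∈ B ∧ flipBit k v ∈ B).card ≤ 2 * B'.card := by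
  have hsub : (univ.filter fun v => v ∈ B ∧ flipBit k v ∈ B) ⊆ B' ∪ B'.image (flipBit k) := by
    intro v hv
    simp only [mem_filter, mem_univ, true_and] at hv
    rw [mem_union, mem_image]
    exact (h v hv.1 hv.2).imp_right fun h => ⟨_, h, flipBit_flipBit k v⟩
  refine (card_le_card hsub).trans ((card_union_le _ _).trans ?_)
  have := card_image_le (s := B') (f := flipBit k)
  omega

/-- The ranks `r₀` on the half `v k = false` followed by the ranks `r₁` on the other half. -/
def mergeRank {n : ℕ} (k : Fin n) (x : ℕ) (r₀ r₁ : (Fin n → Bool) → ℕ) (v : Fin n → Bool) : ℕ :=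
  if v k = true then x + r₁ v else r₀ v

lemma mergeRank_injOn {n x y : ℕ} {B : Finset (Fin n → Bool)} {k : Fin n}
    {r₀ r₁ : (Fin n → Bool) → ℕ}
    (hr₀ : ∀ v ∈ B, v k = false → r₀ v < x) (hr₁ : ∀ v ∈ B, v k = true → r₁ v < y)
    (hi₀ : ∀ u ∈ B, ∀ v ∈ B, u k = false → v k = false → r₀ u = r₀ v → u = v)
    (hi₁ : ∀ u ∈ B, ∀ v ∈ B, u k = true → v k = true → r₁ u = r₁ v → u = v) :
    Set.InjOn (mergeRank k x r₀ r₁) B ∧ ∀ v ∈ B, mergeRank k x r₀ r₁ v < x + y := by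
  refine ⟨fun u hu v hv e => ?_, fun v hv => ?_⟩
  · cases hku : u k <;> cases hkv : v k <;> simp [mergeRank, hku, hkv] at e
    · exact hi₀ u hu v hv hku hkv e
    · have := hr₀ u hu hku
      omega
    · have := hr₀ v hv hkv
      omega
    · exact hi₁ u hu v hv hku hkv e
  · cases hkv : v k <;> simp [mergeRank, hkv]
    · exact (hr₀ v hv hkv).trans_le (Nat.le_add_right _ _)
    · exact hr₁ v hv hkv

/-- Every set of vertices can be ordered so that its induced edges are short on average. -/
lemma exists_inducedLength_le {n : ℕ} (B : Finset (Fin n → Bool)) :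
    ∃ r : (Fin n → Bool) → ℕ, Set.InjOn r B ∧ (∀ v ∈ B, r v < B.card) ∧
      inducedLength B r + B.card ≤ B.card * B.card := by
  induction B using Finset.strongInduction with
  | H B ih =>
  rcases le_or_gt B.card 1 with hB | hB
  · refine ⟨fun _ => 0, fun u hu v hv _ => card_le_one.1 hB u hu v hv,
      fun v hv => card_pos.2 ⟨v, hv⟩, ?_⟩
    simp only [inducedLength, Nat.dist_self, ite_self, sum_const_zero, zero_add]
    exact Nat.le_mul_self _
  obtain ⟨u, hu, w, hw, huw⟩ := one_lt_card.1 hB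
  obtain ⟨k, hk⟩ := Function.ne_iff.1 huw
  have hproper : ∀ c, B.filter (fun v => v k = c) ⊂ B := fun c => by
    rw [filter_ssubset]
    by_cases h : u k = c
    · exact ⟨w, hw, fun h' => hk (h.trans h'.symm)⟩
    · exact ⟨u, hu, h⟩
  obtain ⟨r₀, hi₀, hr₀, hc₀⟩ := ih _ (hproper false)
  obtain ⟨r₁, hi₁, hr₁, hc₁⟩ := ih _ (hproper true)
  set x := (B.filter fun v => v k = false).card with hx
  set y := (B.filter fun v => v k = true).card with hy
  have hxy : x + y = B.card := by
    rw [← card_filter_add_card_filter_not (s := B) (fun v => v k = false)]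
    simp only [Bool.not_eq_false, hx, hy]
  have hr₀' : ∀ v ∈ B, v k = false → r₀ v < x := fun v h h' => hr₀ v (mem_filter.2 ⟨h, h'⟩)
  have hr₁' : ∀ v ∈ B, v k = true → r₁ v < y := fun v h h' => hr₁ v (mem_filter.2 ⟨h, h'⟩)
  have hi₀' : ∀ u ∈ B, ∀ v ∈ B, u k = false → v k = false → r₀ u = r₀ v → u = v :=
    fun u hu v hv h h' e => hi₀ (by simp [hu, h]) (by simp [hv, h']) e
  have hi₁' : ∀ u ∈ B, ∀ v ∈ B, u k = true → v k = true → r₁ u = r₁ v → u = v :=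
    fun u hu v hv h h' e => hi₁ (by simp [hu, h]) (by simp [hv, h']) e
  let r := mergeRank k x r₀ r₁
  let r' := mergeRank k x (fun v => x - 1 - r₀ v) (fun v => y - 1 - r₁ v)
  set C := univ.filter fun v => v ∈ B ∧ flipBit k v ∈ B with hC
  have hCx : C.card ≤ 2 * x := card_filter_flipBit_le fun v hv hv' => by
    simp only [mem_filter, hv, hv', true_and, flipBit_apply_self]
    cases v k <;> simp
  have hCy : C.card ≤ 2 * y := card_filter_flipBit_le fun v hv hv' => by
    simp only [mem_filter, hv, hv', true_and, flipBit_apply_self]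
    cases v k <;> simp
  have hsum : inducedLength B r + inducedLength B r' ≤
      2 * inducedLength (B.filter fun v => v k = false) r₀ +
        2 * inducedLength (B.filter fun v => v k = true) r₁ + C.card * (x + y) := by
    have hcross : C.card * (x + y) =
        ∑ j, ∑ v, if j = k ∧ v ∈ B ∧ flipBit j v ∈ B then x + y else 0 := by
      rw [Fintype.sum_eq_single k fun j hj => by simp [hj], hC, card_filter, sum_mul]
      simp
    rw [hcross]
    simp only [inducedLength, mul_sum, ← sum_add_distrib]
    refine sum_le_sum fun j _ => sum_le_sum fun v _ => ?_
    by_cases hv : v ∈ B ∧ flipBit j v ∈ B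
    swap
    · have h₀ : ∀ c, ¬ ((v ∈ B ∧ v k = c) ∧ flipBit j v ∈ B ∧ flipBit j v k = c) := by tauto
      simp [hv]
    obtain ⟨hv, hv'⟩ := hv
    have a₀ := hr₀' v hv
    have a₁ := hr₁' v hv
    have b₀ := hr₀' _ hv'
    have b₁ := hr₁' _ hv'
    simp only [mem_filter, hv, hv', true_and, and_true, if_true, r, r', mergeRank, Nat.dist]
    by_cases hj : j = k
    · subst hj
      rw [flipBit_apply_self] at b₀ b₁ ⊢
      cases h : v j <;> simp [h] at a₀ a₁ b₀ b₁ ⊢ <;> omega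
    · rw [flipBit_apply_of_ne (Ne.symm hj)] at b₀ b₁ ⊢
      cases h : v k <;> simp [h, hj] at a₀ a₁ b₀ b₁ ⊢ <;> omega
  have hsmall : C.card * (x + y) ≤ 4 * (x * y) := by
    rcases le_total x y with h | h <;> nlinarith
  have hor : inducedLength B r + B.card ≤ B.card * B.card ∨
      inducedLength B r' + B.card ≤ B.card * B.card := by
    rw [← hxy]
    by_contra! h
    nlinarith
  rcases hor with h | h
  · obtain ⟨hi, hr⟩ := mergeRank_injOn hr₀' hr₁' hi₀' hi₁'
    exact ⟨r, hi, fun v hv => hxy ▸ hr v hv, h⟩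
  · obtain ⟨hi, hr⟩ := mergeRank_injOn (k := k) (B := B) (x := x) (y := y)
      (r₀ := fun v => x - 1 - r₀ v) (r₁ := fun v => y - 1 - r₁ v)
      (fun v hv h => by have := hr₀' v hv h; omega) (fun v hv h => by have := hr₁' v hv h; omega)
      (fun u hu v hv h h' e => hi₀' u hu v hv h h' <| by
        have := hr₀' u hu h
        have := hr₀' v hv h'
        omega)
      (fun u hu v hv h h' e => hi₁' u hu v hv h h' <| by
        have := hr₁' u hu h
        have := hr₁' v hv h'
        omega)
    exact ⟨r', hi, fun v hv => hxy ▸ hr v hv, h⟩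

lemma cycDist_add_cycDist_reverse_le {K M a b p q : ℕ} (ha : a < 2 * M) (hb : b < 2 * M)
    (hp : p < K) (hq : q < K) :
    cycDist (2 * (K * M)) (K * a + p) (K * b + q) +
        cycDist (2 * (K * M)) (K * a + (K - 1 - p)) (K * b + (K - 1 - q)) ≤
      2 * K * cycDist (2 * M) a b + if a = b then 2 * Nat.dist p q else 0 := by
  wlog hab : a ≤ b generalizing a b p q
  · have h := this hb ha hq hp (le_of_not_ge hab)
    simp only [cycDist, Nat.dist_comm] at h ⊢
    simpa only [eq_comm] using h
  obtain ⟨d, rfl⟩ := Nat.exists_eq_add_of_le hab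
  rcases d.eq_zero_or_pos with rfl | hd
  · simp only [cycDist, add_zero, Nat.dist, if_true]
    omega
  · have hdist : Nat.dist a (a + d) = d := by
      simp only [Nat.dist]
      omega
    rw [if_neg (by omega), add_zero, cycDist, cycDist, cycDist, hdist, mul_add K a d]
    obtain ⟨c, hc⟩ : ∃ c, 2 * M = d + c := Nat.exists_eq_add_of_le (by omega)
    have hKd : K ≤ K * d := Nat.le_mul_of_pos_right K hd
    have hKc : K ≤ K * c := Nat.le_mul_of_pos_right K (by omega)
    have hKM : 2 * (K * M) = K * d + K * c := by rw [← mul_add, ← hc]; ring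
    rw [hKM, hc, Nat.add_sub_cancel_left, ← Nat.mul_min_mul_left, mul_assoc 2 K d,
      mul_assoc 2 K c]
    simp only [Nat.dist]
    omega

/-- Layouts into `2 * M` consecutive blocks of size `K` satisfy the same bound as bijective
layouts, up to scaling. -/
lemma le_sum_cycDist_of_card_fiber_le {m K M : ℕ} (hm : 4 ≤ m) (h2KM : 2 * (K * M) = 2 ^ m)
    {b : (Fin m → Bool) → ℕ} (hb : ∀ v, b v < 2 * M)
    (hfib : ∀ i, (univ.filter fun v => b v = i).card ≤ K) :
    (K * (M * (3 * M - 2)) : ℤ) ≤ ∑ k, ∑ v, (cycDist (2 * M) (b v) (b (flipBit k v)) : ℤ) := by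
  obtain ⟨n, rfl⟩ : ∃ n, m = n + 3 + 1 := ⟨m - 4, by omega⟩
  have hKM : K * M = 2 ^ (n + 3) := by
    rw [pow_succ] at h2KM
    omega
  choose r hinj hlt hcost using
    fun i => exists_inducedLength_le (univ.filter fun v => b v = i)
  set p : (Fin (n + 3 + 1) → Bool) → ℕ := fun v => r (b v) v with hp
  have hpK : ∀ v, p v < K := fun v => (hlt (b v) v (by simp)).trans_le (hfib _)
  have hpinj : ∀ u v, b u = b v → p u = p v → u = v := fun u v h e =>
    hinj (b v) (by simp [h]) (by simp) (by simpa [hp, h] using e)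
  have hlayout : ∀ q : (Fin (n + 3 + 1) → Bool) → ℕ, (∀ v, q v < K) →
      (∀ u v, b u = b v → q u = q v → u = v) →
      (2 ^ (n + 3) * (3 * 2 ^ (n + 3) - 2) : ℤ) ≤ ∑ k, ∑ v,
        (cycDist (2 * (K * M)) (K * b v + q v) (K * b (flipBit k v) + q (flipBit k v)) : ℤ) := by
    intro q hq hqinj
    have hdiv : ∀ v, (K * b v + q v) / K = b v := fun v => by
      rw [Nat.mul_add_div (pos_of_gt (hq v)), Nat.div_eq_of_lt (hq v), add_zero]
    rw [hKM]
    refine le_sum_cycDist (F := fun v => K * b v + q v) (fun u v h => ?_) fun v => ?_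
    · have h' : b u = b v := by rw [← hdiv u, ← hdiv v]; exact congrArg (· / K) h
      exact hqinj u v h' (by simpa [h'] using h)
    · rw [← hKM]
      have := hq v
      have := Nat.mul_le_mul_left K (Nat.succ_le_of_lt (hb v))
      rw [Nat.mul_succ] at this
      linarith
  have h₁ := hlayout p hpK hpinj
  have h₂ := hlayout (fun v => K - 1 - p v) (fun v => by have := hpK v; omega) fun u v h e =>
    hpinj u v h (by have := hpK u; have := hpK v; omega)
  have hpair : ∑ k, ∑ v, (cycDist (2 * (K * M)) (K * b v + p v)
          (K * b (flipBit k v) + p (flipBit k v)) : ℤ) +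
        ∑ k, ∑ v, (cycDist (2 * (K * M)) (K * b v + (K - 1 - p v))
          (K * b (flipBit k v) + (K - 1 - p (flipBit k v))) : ℤ) ≤
      2 * K * ∑ k, ∑ v, (cycDist (2 * M) (b v) (b (flipBit k v)) : ℤ) +
        2 * ∑ k, ∑ v,
          ((if b v = b (flipBit k v) then Nat.dist (p v) (p (flipBit k v)) else 0 : ℕ) : ℤ) := by
    simp only [mul_sum, ← sum_add_distrib]
    refine sum_le_sum fun k _ => sum_le_sum fun v _ => ?_
    have h := cycDist_add_cycDist_reverse_le (hb v) (hb (flipBit k v)) (hpK v) (hpK (flipBit k v))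
    by_cases e : b v = b (flipBit k v)
    · rw [if_pos e] at h ⊢
      exact_mod_cast h
    · rw [if_neg e] at h ⊢
      exact_mod_cast h
  have hinner : ∑ k, ∑ v, (if b v = b (flipBit k v) then Nat.dist (p v) (p (flipBit k v)) else 0) +
      2 * M * K ≤ 2 * M * (K * K) := by
    have hsplit : ∑ k, ∑ v,
        (if b v = b (flipBit k v) then Nat.dist (p v) (p (flipBit k v)) else 0) =
        ∑ i ∈ range (2 * M), inducedLength (univ.filter fun v => b v = i) (r i) := by
      simp only [inducedLength]
      symm
      rw [sum_comm]
      refine sum_congr rfl fun k _ => ?_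
      rw [sum_comm]
      refine sum_congr rfl fun v _ => ?_
      rw [sum_eq_single_of_mem (b v) (mem_range.2 (hb v))]
      · by_cases h : b v = b (flipBit k v)
        · simp [hp, h]
        · simp [h, Ne.symm h]
      · intro i _ hi
        simp [Ne.symm hi]
    have hi : ∀ i ∈ range (2 * M),
        inducedLength (univ.filter fun v => b v = i) (r i) + K ≤ K * K := fun i _ => by
      have h₁ := hcost i
      have h₂ := hfib i
      rcases Nat.eq_zero_or_pos (univ.filter fun v => b v = i).card with h | h
      · have := Nat.le_mul_self K
        rw [h] at h₁
        omega
      · nlinarith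
    have := sum_le_sum hi
    rw [sum_add_distrib, sum_const, sum_const, card_range, smul_eq_mul, smul_eq_mul] at this
    rwa [hsplit]
  have hK : (0 : ℤ) < K := by
    have : 0 < K := pos_of_gt (hpK fun _ => true)
    exact_mod_cast this
  have hP : ((2 : ℤ) ^ (n + 3)) = K * M := by exact_mod_cast hKM.symm
  rw [hP] at h₁ h₂
  have hinner' : ∑ k, ∑ v, ((if b v = b (flipBit k v) then Nat.dist (p v) (p (flipBit k v))
      else 0 : ℕ) : ℤ) + 2 * M * K ≤ 2 * M * (K * K) := by exact_mod_cast hinner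
  refine le_of_mul_le_mul_left ?_ hK
  linarith

lemma sum_Icc_ite_mem_Icc {M x y : ℕ} (hx : 1 ≤ x) (hx' : x ≤ 2 * M) (hy : 1 ≤ y)
    (hy' : y ≤ 2 * M) :
    ∑ i ∈ Icc 1 M, (if (x ∈ Icc i (i + M - 1) ↔ y ∈ Icc i (i + M - 1)) then 0 else 1) =
      cycDist (2 * M) x y := by
  have hmem : ∀ z t, 1 ≤ z → z ≤ 2 * M → t < M →
      (z ∈ Icc (1 + t) (1 + t + M - 1) ↔ ¬ (2 * M - z + t) % (2 * M) < M) := by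
    intro z t hz hz' ht
    rw [mem_Icc]
    rcases lt_or_ge (2 * M - z + t) (2 * M) with h | h
    · rw [Nat.mod_eq_of_lt h]
      omega
    · rw [Nat.mod_eq_sub_mod h, Nat.mod_eq_of_lt (by omega)]
      omega
  have hshift : cycDist (2 * M) x y = cycDist (2 * M) (2 * M - x) (2 * M - y) := by
    simp only [cycDist, Nat.dist]
    omega
  rw [hshift, ← sum_range_ite_mod_lt (by omega) (by omega), ← Ico_add_one_right_eq_Icc,
    sum_Ico_eq_sum_range, Nat.add_sub_cancel]
  refine sum_congr rfl fun t ht => if_congr ?_ rfl rfl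
  rw [hmem x t hx hx' (mem_range.1 ht), hmem y t hy hy' (mem_range.1 ht), not_iff_not]

/-- The boundaries of the half-length windows of a labelling add up to its circular wirelength. -/
lemma two_mul_sum_theta_window {n M : ℕ} {g : (Fin n → Bool) → ℕ} (hg : ∀ v, 1 ≤ g v)
    (hg' : ∀ v, g v ≤ 2 * M) :
    2 * ∑ i ∈ Icc 1 M, (theta n (univ.filter fun v => g v ∈ Icc i (i + M - 1)) : ℤ) =
      ∑ k, ∑ v, (cycDist (2 * M) (g v) (g (flipBit k v)) : ℤ) := by
  rw [mul_sum]
  simp_rw [two_mul_theta_eq_sum, mem_filter, mem_univ, true_and]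
  rw [sum_comm]
  refine sum_congr rfl fun k _ => ?_
  rw [sum_comm]
  refine sum_congr rfl fun v _ => ?_
  rw [← sum_Icc_ite_mem_Icc (hg v) (hg' v) (hg _) (hg' _)]
  push_cast
  rfl

lemma gray_mem_Icc (n : ℕ) (v : Fin n → Bool) : gray n v ∈ Icc 1 (2 ^ n) := by
  induction n with
  | zero => simp [gray]
  | succ n ih =>
    have h := mem_Icc.1 (ih fun i => v i.succ)
    have e : 2 ^ (n + 1) = 2 * 2 ^ n := by ring
    rw [mem_Icc, gray]
    split_ifs <;> omega

lemma gray_insertBit_false (n : ℕ) (w : Fin n → Bool) :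
    gray (n + 1) (insertBit 0 false w) = gray n w := by
  simp [gray, insertBit]

lemma gray_insertBit_true (n : ℕ) (w : Fin n → Bool) :
    gray (n + 1) (insertBit 0 true w) = 2 ^ (n + 1) + 1 - gray n w := by
  simp [gray, insertBit]

lemma gray_injective (n : ℕ) : Function.Injective (gray n) := by
  induction n with
  | zero => exact Function.injective_of_subsingleton _
  | succ n ih =>
    intro u v h
    have hu := mem_Icc.1 (gray_mem_Icc n fun i => u i.succ)
    have hv := mem_Icc.1 (gray_mem_Icc n fun i => v i.succ)
    have e : 2 ^ (n + 1) = 2 * 2 ^ n := by ring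
    rw [gray, gray] at h
    have h₀ : u 0 = v 0 := by
      cases hu0 : u 0 <;> cases hv0 : v 0 <;> simp [hu0, hv0] at h ⊢ <;> omega
    have h₁ : (fun i : Fin n => u i.succ) = fun i => v i.succ := by
      apply ih
      rw [h₀] at h
      split_ifs at h <;> omega
    funext i
    exact Fin.cases h₀ (fun i => congrFun h₁ i) i

lemma sum_comp_gray {M : Type*} [AddCommMonoid M] (n : ℕ) (φ : ℕ → M) :
    ∑ v, φ (gray n v) = ∑ j ∈ range (2 ^ n), φ (j + 1) := by
  have hg := fun v => mem_Icc.1 (gray_mem_Icc n v)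
  have h := sum_eq_sum_range_of_injective (G := fun v => gray n v - 1)
    (fun u v h => gray_injective n (by have := hg u; have := hg v; simp only at h; omega))
    (fun v => by have := hg v; simp; omega) (fun j => φ (j + 1))
  simp only [Fintype.card_pi, Fintype.card_bool, prod_const, card_univ, Fintype.card_fin] at h
  rw [← h]
  refine sum_congr rfl fun v _ => ?_
  rw [Nat.sub_add_cancel (hg v).1]

/-- The linear wirelength of the Gray code. -/
lemma sum_dist_gray (n : ℕ) :
    ∑ k, ∑ v, (Nat.dist (gray n v) (gray n (flipBit k v)) : ℤ) = 2 ^ n * (2 ^ n - 1) := by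
  induction n with
  | zero => simp
  | succ n ih =>
    have e : 2 ^ (n + 1) = 2 * 2 ^ n := by ring
    rw [sum_flipBit_eq_sum_insertBit 0 fun u v => (Nat.dist (gray (n + 1) u) (gray (n + 1) v) : ℤ)]
    simp only [gray_insertBit_false, gray_insertBit_true]
    have hinner : ∀ j : Fin n, ∀ w, Nat.dist (2 ^ (n + 1) + 1 - gray n w)
        (2 ^ (n + 1) + 1 - gray n (flipBit j w)) = Nat.dist (gray n w) (gray n (flipBit j w)) := by
      intro j w
      have := mem_Icc.1 (gray_mem_Icc n w)
      have := mem_Icc.1 (gray_mem_Icc n (flipBit j w))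
      simp only [Nat.dist]
      omega
    simp only [hinner]
    have hterm : ∀ j ∈ range (2 ^ n), (Nat.dist (2 ^ (n + 1) + 1 - (j + 1)) (j + 1) : ℤ) +
        Nat.dist (j + 1) (2 ^ (n + 1) + 1 - (j + 1)) = 4 * 2 ^ n - 2 - 2 * (2 * j) := by
      intro j hj
      have := mem_range.1 hj
      have h : Nat.dist (2 ^ (n + 1) + 1 - (j + 1)) (j + 1) +
          Nat.dist (j + 1) (2 ^ (n + 1) + 1 - (j + 1)) + 2 + 4 * j = 4 * 2 ^ n := by
        simp only [Nat.dist]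
        omega
      zify at h
      linarith
    rw [ih, sum_comp_gray n fun g => (Nat.dist (2 ^ (n + 1) + 1 - g) g : ℤ) +
      Nat.dist g (2 ^ (n + 1) + 1 - g), sum_congr rfl hterm, sum_sub_distrib, ← mul_sum,
      ← mul_sum, two_mul_sum_range_cast, sum_const, card_range, nsmul_eq_mul]
    push_cast
    ring

lemma sum_range_add_min (q : ℕ) :
    ∑ j ∈ range (q + q), (2 * min (2 * j + 1) (4 * q - 1 - 2 * j) : ℕ) = 4 * q * q := by
  have hodd : ∑ j ∈ range q, (2 * (2 * j + 1)) = 2 * q * q := by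
    induction q with
    | zero => simp
    | succ q ih =>
      rw [sum_range_succ, ih]
      ring
  rw [sum_range_add, sum_congr rfl fun j hj => show _ = 2 * (2 * j + 1) from ?_,
    ← sum_range_reflect (fun j => 2 * min (2 * (q + j) + 1) _),
    sum_congr (s₁ := range q) (f := fun j => 2 * min (2 * (q + (q - 1 - j)) + 1) _) rfl
      fun j hj => show _ = 2 * (2 * j + 1) from ?_, hodd]
  · ring
  · have := mem_range.1 hj
    omega
  · have := mem_range.1 hj
    omega

/-- The circular wirelength of the Gray code. -/
lemma sum_cycDist_gray_le (n : ℕ) :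
    ∑ k, ∑ v, (cycDist (2 * 2 ^ (n + 1)) (gray (n + 2) v) (gray (n + 2) (flipBit k v)) : ℤ) ≤
      2 ^ (n + 1) * (3 * 2 ^ (n + 1) - 2) := by
  have e : 2 ^ (n + 1) = 2 * 2 ^ n := by ring
  have e' : 2 ^ (n + 1 + 1) = 4 * 2 ^ n := by ring
  rw [sum_flipBit_eq_sum_insertBit 0
    fun u v => (cycDist (2 * 2 ^ (n + 1)) (gray (n + 2) u) (gray (n + 2) v) : ℤ)]
  simp only [gray_insertBit_false, gray_insertBit_true]
  have hcross : ∑ w, ((cycDist (2 * 2 ^ (n + 1)) (2 ^ (n + 1 + 1) + 1 - gray (n + 1) w)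
        (gray (n + 1) w) : ℤ) + cycDist (2 * 2 ^ (n + 1)) (gray (n + 1) w)
          (2 ^ (n + 1 + 1) + 1 - gray (n + 1) w)) = 2 ^ (n + 1) * 2 ^ (n + 1) := by
    have h := sum_range_add_min (2 ^ n)
    rw [sum_comp_gray (n + 1) fun g => (cycDist (2 * 2 ^ (n + 1)) (2 ^ (n + 1 + 1) + 1 - g) g : ℤ) +
      cycDist (2 * 2 ^ (n + 1)) g (2 ^ (n + 1 + 1) + 1 - g)]
    norm_cast
    rw [← two_mul (2 ^ n), ← e] at h
    rw [show 2 ^ (n + 1) * 2 ^ (n + 1) = 4 * 2 ^ n * 2 ^ n by ring, ← h]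
    refine sum_congr rfl fun j hj => ?_
    have := mem_range.1 hj
    simp only [cycDist, Nat.dist]
    omega
  have hle : ∀ a b, (cycDist (2 * 2 ^ (n + 1)) a b : ℤ) ≤ Nat.dist a b := fun a b =>
    Nat.cast_le.2 (min_le_left _ _)
  have hinner : ∀ j : Fin (n + 1), ∀ w, Nat.dist (2 ^ (n + 1 + 1) + 1 - gray (n + 1) w)
      (2 ^ (n + 1 + 1) + 1 - gray (n + 1) (flipBit j w)) =
        Nat.dist (gray (n + 1) w) (gray (n + 1) (flipBit j w)) := by
    intro j w
    have := mem_Icc.1 (gray_mem_Icc (n + 1) w)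
    have := mem_Icc.1 (gray_mem_Icc (n + 1) (flipBit j w))
    simp only [Nat.dist]
    omega
  have h₁ : ∑ j, ∑ w, (cycDist (2 * 2 ^ (n + 1)) (2 ^ (n + 1 + 1) + 1 - gray (n + 1) w)
      (2 ^ (n + 1 + 1) + 1 - gray (n + 1) (flipBit j w)) : ℤ) ≤
        2 ^ (n + 1) * (2 ^ (n + 1) - 1) := by
    rw [← sum_dist_gray]
    refine sum_le_sum fun j _ => sum_le_sum fun w _ => ?_
    rw [← hinner]
    exact hle _ _
  have h₂ : ∑ j, ∑ w, (cycDist (2 * 2 ^ (n + 1)) (gray (n + 1) w)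
      (gray (n + 1) (flipBit j w)) : ℤ) ≤ 2 ^ (n + 1) * (2 ^ (n + 1) - 1) := by
    rw [← sum_dist_gray]
    exact sum_le_sum fun j _ => sum_le_sum fun w _ => hle _ _
  rw [hcross]
  linarith

/-- A wirelength that only depends on the first coordinates. -/
lemma sum_flipBit_castAdd {M : Type*} [AddCommMonoid M] (m n : ℕ)
    (φ : (Fin m → Bool) → (Fin m → Bool) → M) (hφ : ∀ u, φ u u = 0) :
    ∑ k, ∑ v : Fin (m + n) → Bool, φ (fun i => v (Fin.castAdd n i))
        (fun i => flipBit k v (Fin.castAdd n i)) =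
      2 ^ n • ∑ k, ∑ u, φ u (flipBit k u) := by
  have hcast : ∀ (k : Fin m) (v : Fin (m + n) → Bool),
      (fun i => flipBit (Fin.castAdd n k) v (Fin.castAdd n i)) =
        flipBit k fun i => v (Fin.castAdd n i) := fun k v => by
    funext i
    simp [flipBit, Function.update_apply]
  have hnat : ∀ (k : Fin n) (v : Fin (m + n) → Bool),
      (fun i => flipBit (Fin.natAdd m k) v (Fin.castAdd n i)) =
        fun i => v (Fin.castAdd n i) := fun k v => by
    funext i
    refine flipBit_apply_of_ne ?_ v
    simp [Fin.ext_iff]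
    omega
  rw [Fin.sum_univ_add]
  simp only [hcast, hnat, hφ, sum_const_zero, add_zero]
  rw [smul_sum]
  refine sum_congr rfl fun k _ => ?_
  rw [← (Fin.appendEquiv m n).sum_comp, Fintype.sum_prod_type_right]
  simp [Fin.appendEquiv]

theorem stmt13 (n₁ n₂ : ℕ) (h₁ : 2 ≤ n₁) (h₂ : 2 ≤ n₂)
    (f : (Fin (n₁ + n₂) → Bool) → ℕ × ℕ)
    (hf : Set.BijOn f Set.univ ((Set.Icc 1 (2 ^ n₁)) ×ˢ (Set.Icc 1 (2 ^ n₂)))) :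
    ∑ i ∈ Finset.Icc 1 (2 ^ (n₁ - 1)),
        theta (n₁ + n₂) (Finset.univ.filter fun v : Fin (n₁ + n₂) → Bool =>
          f v ∈ (Finset.Icc i (i + 2 ^ (n₁ - 1) - 1)) ×ˢ Finset.Icc 1 (2 ^ n₂)) ≥
      ∑ i ∈ Finset.Icc 1 (2 ^ (n₁ - 1)),
        theta (n₁ + n₂) (Finset.univ.filter fun v : Fin (n₁ + n₂) → Bool =>
          gray2 n₁ n₂ v ∈ (Finset.Icc i (i + 2 ^ (n₁ - 1) - 1)) ×ˢ Finset.Icc 1 (2 ^ n₂)) := by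
  obtain ⟨n₁, rfl⟩ := Nat.exists_eq_add_of_le' h₁
  obtain ⟨n₂, rfl⟩ := Nat.exists_eq_add_of_le' h₂
  have hM : 2 ^ (n₁ + 2) = 2 * 2 ^ (n₁ + 1) := by ring
  have hmaps : ∀ v, (1 ≤ (f v).1 ∧ (f v).1 ≤ 2 * 2 ^ (n₁ + 1)) ∧
      1 ≤ (f v).2 ∧ (f v).2 ≤ 2 ^ (n₂ + 2) := fun v => by
    have h := hf.mapsTo (Set.mem_univ v)
    rwa [Set.mem_prod, Set.mem_Icc, Set.mem_Icc, hM] at h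
  have hgray : ∀ v, 1 ≤ gray (n₁ + 2) v ∧ gray (n₁ + 2) v ≤ 2 * 2 ^ (n₁ + 1) := fun v => by
    rw [← hM]
    exact mem_Icc.1 (gray_mem_Icc _ v)
  simp only [mem_product, gray2, gray_mem_Icc, mem_Icc.2 (hmaps _).2, and_true,
    show n₁ + 2 - 1 = n₁ + 1 from rfl, ge_iff_le]
  have hlower := two_mul_sum_theta_window (fun v => (hmaps v).1.1) fun v => (hmaps v).1.2
  have hupper := two_mul_sum_theta_window
    (g := fun v : Fin (n₁ + 2 + (n₂ + 2)) → Bool =>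
      gray (n₁ + 2) fun i => v (Fin.castAdd (n₂ + 2) i))
    (fun v => (hgray _).1) fun v => (hgray _).2
  rw [sum_flipBit_castAdd (n₁ + 2) (n₂ + 2)
    (fun u v => (cycDist (2 * 2 ^ (n₁ + 1)) (gray (n₁ + 2) u) (gray (n₁ + 2) v) : ℤ))
    fun u => by simp [cycDist]] at hupper
  have hgraySum := sum_cycDist_gray_le n₁
  have hfib : ∀ i, (univ.filter fun v => (f v).1 - 1 = i).card ≤ 2 ^ (n₂ + 2) := fun i => by
    have h := card_le_card_of_injOn (s := univ.filter fun v => (f v).1 - 1 = i)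
      (t := Icc 1 (2 ^ (n₂ + 2))) (fun v => (f v).2) (fun v _ => mem_Icc.2 (hmaps v).2) ?_
    · rwa [Nat.card_Icc, Nat.add_sub_cancel] at h
    · intro u hu v hv h
      simp only [coe_filter, mem_univ, true_and, Set.mem_ofPred_eq] at hu hv
      have hu' := (hmaps u).1.1
      have hv' := (hmaps v).1.1
      exact hf.injOn (Set.mem_univ u) (Set.mem_univ v) (Prod.ext (by omega) h)
  have hblock := le_sum_cycDist_of_card_fiber_le
    (K := 2 ^ (n₂ + 2)) (M := 2 ^ (n₁ + 1)) (b := fun v => (f v).1 - 1)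
    (by omega) (by ring) (fun v => by have := hmaps v; omega) hfib
  have hshift : ∀ u v, cycDist (2 * 2 ^ (n₁ + 1)) ((f u).1 - 1) ((f v).1 - 1) =
      cycDist (2 * 2 ^ (n₁ + 1)) (f u).1 (f v).1 := fun u v => by
    have := (hmaps u).1.1
    have := (hmaps v).1.1
    simp only [cycDist, Nat.dist]
    omega
  simp only [hshift] at hblock
  zify
  have hK : (0 : ℤ) ≤ 2 ^ (n₂ + 2) := by positivity
  have := mul_le_mul_of_nonneg_left hgraySum hK
  rw [nsmul_eq_mul] at hupper
  push_cast at hupper hblock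
  linarith
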